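/- The attribute domain for minimal attack time is compatible with the SP semantics: let β : 𝔹 → ℝ≥0 be any basic assignment, and define the evaluation α on SAND attack trees recursively by α(b) = β(b), α(OR(t1,...,tk)) = min{α(t1),...,α(tk)}, α(AND(t1,...,tk)) = max{α(t1),...,α(tk)}, and α(SAND(t1,...,tk)) = α(t1) + ... + α(tk). Then for all SAND attack trees t and t', if ⟦t⟧ = ⟦t'⟧ then α(t) = α(t'). -/

import Mathlib

/-!
Formalization of "Attack Trees with Sequential Conjunction".

Source-sink graphs over a set `B` of basic actions: a vertex type `V`,
a multiset of labeled edges, a source `s` and a sink `z` with `s ≠ z`.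
-/

structure SSG (B : Type) : Type 1 where
  V : Type
  deq : DecidableEq V
  E : Multiset (V × B × V)
  s : V
  z : V
  ne : s ≠ z

namespace SSG

variable {B : Type}

/-- The graph with a single edge labeled `b`. -/
def single (b : B) : SSG B where
  V := Bool
  deq := inferInstance
  E := {(false, b, true)}
  s := false
  z := true
  ne := Bool.false_ne_true

/-- In the sequential composition, the sink of the first graph is identified with
the source of the second graph. -/
def seqEmbed (G G' : SSG B) (v : G.V) : ({u : G.V // u ≠ G.z} ⊕ G'.V) :=
  haveI := G.deq
  if h : v = G.z then Sum.inr G'.s else Sum.inl ⟨v, h⟩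

/-- Sequential composition `G ⋅ G'` of source-sink graphs: the disjoint union in which
the sink of `G` is identified with the source of `G'`. -/
def seq (G G' : SSG B) : SSG B where
  V := {u : G.V // u ≠ G.z} ⊕ G'.V
  deq := by haveI := G.deq; haveI := G'.deq; infer_instance
  E := G.E.map (fun e => (G.seqEmbed G' e.1, e.2.1, G.seqEmbed G' e.2.2)) +
       G'.E.map (fun e => (Sum.inr e.1, e.2.1, Sum.inr e.2.2))
  s := Sum.inl ⟨G.s, G.ne⟩
  z := Sum.inr G'.z
  ne := by simp

/-- In the parallel composition, the two sources are identified and the two sinks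
are identified. -/
def parEmbed (G G' : SSG B) (v : G.V) : ({u : G.V // u ≠ G.s ∧ u ≠ G.z} ⊕ G'.V) :=
  haveI := G.deq
  if hs : v = G.s then Sum.inr G'.s
  else if hz : v = G.z then Sum.inr G'.z
  else Sum.inl ⟨v, hs, hz⟩

/-- Parallel composition `G ∥ G'` of source-sink graphs: the disjoint union in which
the two sources are identified and the two sinks are identified. -/
def par (G G' : SSG B) : SSG B where
  V := {u : G.V // u ≠ G.s ∧ u ≠ G.z} ⊕ G'.V
  deq := by haveI := G.deq; haveI := G'.deq; infer_instance
  E := G.E.map (fun e => (G.parEmbed G' e.1, e.2.1, G.parEmbed G' e.2.2)) +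
       G'.E.map (fun e => (Sum.inr e.1, e.2.1, Sum.inr e.2.2))
  s := Sum.inr G'.s
  z := Sum.inr G'.z
  ne := fun h => G'.ne (Sum.inr_injective h)

/-- Two source-sink graphs are equal (isomorphic) if there is a bijection between their
vertex sets that preserves the labeled edges (and hence source and sink). -/
def Iso (G G' : SSG B) : Prop :=
  ∃ f : G.V ≃ G'.V,
    G.E.map (fun e => (f e.1, e.2.1, f e.2.2)) = G'.E ∧ f G.s = G'.s ∧ f G.z = G'.z

/-- Directed adjacency: there is an edge from `u` to `v`. -/
def Adj (G : SSG B) (u v : G.V) : Prop := ∃ b, (u, b, v) ∈ G.E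

/-- Series-parallel graphs (SP graphs): built from single edges by sequential and
parallel composition; as SP graphs are considered up to isomorphism, the collection
is closed under isomorphism. -/
inductive IsSP : SSG B → Prop
  | single (b : B) : IsSP (single b)
  | seq {G G' : SSG B} : IsSP G → IsSP G' → IsSP (G.seq G')
  | par {G G' : SSG B} : IsSP G → IsSP G' → IsSP (G.par G')
  | iso {G G' : SSG B} : IsSP G → G.Iso G' → IsSP G'

/-- A graph is connected if any two vertices are joined by a path in the
underlying undirected graph. -/
def Connected (G : SSG B) : Prop :=
  ∀ u v : G.V, Relation.ReflTransGen (fun a b => G.Adj a b ∨ G.Adj b a) u v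

/-- A directed graph is acyclic if it has no (nonempty) directed cycle. -/
def Acyclic (G : SSG B) : Prop := ∀ v : G.V, ¬ Relation.TransGen G.Adj v v

end SSG
/-!
SAND attack trees: closed terms over `B ∪ {OR, AND, SAND}`, where the unranked
operators take `k ≥ 1` arguments (represented by nonempty lists `SandTreeList`).
-/

mutual
inductive SandTree (B : Type) : Type
  | atom : B → SandTree B
  | or : SandTreeList B → SandTree B
  | and : SandTreeList B → SandTree B
  | sand : SandTreeList B → SandTree B
inductive SandTreeList (B : Type) : Type
  | single : SandTree B → SandTreeList B
  | cons : SandTree B → SandTreeList B → SandTreeList B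
end

namespace SandTreeList

variable {B : Type}

def toList : SandTreeList B → List (SandTree B)
  | .single t => [t]
  | .cons t ts => t :: ts.toList

/-- Prepend a (possibly empty) list of trees to a nonempty argument list. -/
def glue : List (SandTree B) → SandTreeList B → SandTreeList B
  | [], ys => ys
  | x :: xs, ys => .cons x (glue xs ys)

/-- The nonempty argument list `t :: l`. -/
def ofList : SandTree B → List (SandTree B) → SandTreeList B
  | t, [] => .single t
  | t, u :: us => .cons t (ofList u us)

/-- Append a (possibly empty) list of trees to a nonempty argument list. -/
def snoc : SandTreeList B → List (SandTree B) → SandTreeList B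
  | .single t, zs => ofList t zs
  | .cons t ts, zs => .cons t (snoc ts zs)

def map (f : SandTree B → SandTree B) : SandTreeList B → SandTreeList B
  | .single t => .single (f t)
  | .cons t ts => .cons (f t) (map f ts)

end SandTreeList

/-!
The SP semantics `sem` interprets a SAND attack tree as a set of SP graphs
(sets of source-sink graphs closed under isomorphism, since SP graphs are
considered up to isomorphism):
`⟦b⟧ = {→b}`, `⟦OR(t₁,…,t_k)⟧ = ⋃ᵢ ⟦tᵢ⟧`,
`⟦AND(t₁,…,t_k)⟧ = {G₁ ∥ … ∥ G_k | Gᵢ ∈ ⟦tᵢ⟧}`,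
`⟦SAND(t₁,…,t_k)⟧ = {G₁ ⋅ … ⋅ G_k | Gᵢ ∈ ⟦tᵢ⟧}`.
-/

mutual
def sem {B : Type} : SandTree B → Set (SSG B)
  | .atom b => {G | (SSG.single b).Iso G}
  | .or ts => semOr ts
  | .and ts => semAnd ts
  | .sand ts => semSand ts
def semOr {B : Type} : SandTreeList B → Set (SSG B)
  | .single t => sem t
  | .cons t ts => sem t ∪ semOr ts
def semAnd {B : Type} : SandTreeList B → Set (SSG B)
  | .single t => sem t
  | .cons t ts => {G | ∃ G1 ∈ sem t, ∃ G2 ∈ semAnd ts, (G1.par G2).Iso G}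
def semSand {B : Type} : SandTreeList B → Set (SSG B)
  | .single t => sem t
  | .cons t ts => {G | ∃ G1 ∈ sem t, ∃ G2 ∈ semSand ts, (G1.seq G2).Iso G}
end
/-!
Equality of terms modulo commutativity of the unranked operators `OR` and `AND`
(the congruence generated by permuting the arguments of `OR` and `AND` nodes).
-/

mutual
inductive PEq {B : Type} : SandTree B → SandTree B → Prop
  | refl (t : SandTree B) : PEq t t
  | symm {t u : SandTree B} : PEq t u → PEq u t
  | trans {t u v : SandTree B} : PEq t u → PEq u v → PEq t v
  | orPerm {ts ts' : SandTreeList B} : ts.toList.Perm ts'.toList → PEq (.or ts) (.or ts')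
  | andPerm {ts ts' : SandTreeList B} : ts.toList.Perm ts'.toList → PEq (.and ts) (.and ts')
  | orCongr {ts ts' : SandTreeList B} : PEqL ts ts' → PEq (.or ts) (.or ts')
  | andCongr {ts ts' : SandTreeList B} : PEqL ts ts' → PEq (.and ts) (.and ts')
  | sandCongr {ts ts' : SandTreeList B} : PEqL ts ts' → PEq (.sand ts) (.sand ts')
inductive PEqL {B : Type} : SandTreeList B → SandTreeList B → Prop
  | single {t t' : SandTree B} : PEq t t' → PEqL (.single t) (.single t')
  | cons {t t' : SandTree B} {ts ts' : SandTreeList B} :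
      PEq t t' → PEqL ts ts' → PEqL (.cons t ts) (.cons t' ts')
end
/-!
Syntactic consequence from the axiom system `E_SP`.

The axiom schemes are represented by all of their instances (arbitrary argument
terms in place of the variable vectors `X⃗`, `Y⃗`, `Z⃗`); on closed terms this
generates exactly the same derivability relation as variables plus the
substitution rule.  Closure under "replacement in contexts" is represented by
the congruence rules for the three operators.
-/

section
open SandTreeList
mutual
inductive DerivSP {B : Type} : SandTree B → SandTree B → Prop
  /- closure rules -/
  | refl (t : SandTree B) : DerivSP t t
  | symm {t u : SandTree B} : DerivSP t u → DerivSP u t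
  | trans {t u v : SandTree B} : DerivSP t u → DerivSP u v → DerivSP t v
  | congrOr {ts ts' : SandTreeList B} : DerivSPL ts ts' → DerivSP (.or ts) (.or ts')
  | congrAnd {ts ts' : SandTreeList B} : DerivSPL ts ts' → DerivSP (.and ts) (.and ts')
  | congrSand {ts ts' : SandTreeList B} : DerivSPL ts ts' → DerivSP (.sand ts) (.sand ts')
  /- (E1) commutativity of OR -/
  | ax1 {ts ts' : SandTreeList B} : ts.toList.Perm ts'.toList → DerivSP (.or ts) (.or ts')
  /- (E2) commutativity of AND -/
  | ax2 {ts ts' : SandTreeList B} : ts.toList.Perm ts'.toList → DerivSP (.and ts) (.and ts')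
  /- (E3) OR(X⃗, OR(Y⃗)) = OR(X⃗, Y⃗) -/
  | ax3 (xs : List (SandTree B)) (ys : SandTreeList B) :
      DerivSP (.or (glue xs (.single (.or ys)))) (.or (glue xs ys))
  /- (E4) AND(X⃗, AND(Y⃗)) = AND(X⃗, Y⃗) -/
  | ax4 (xs : List (SandTree B)) (ys : SandTreeList B) :
      DerivSP (.and (glue xs (.single (.and ys)))) (.and (glue xs ys))
  /- (E4') SAND(X⃗, SAND(Y⃗), Z⃗) = SAND(X⃗, Y⃗, Z⃗) -/
  | ax4' (xs : List (SandTree B)) (ys : SandTreeList B) (zs : List (SandTree B)) :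
      DerivSP (.sand (glue xs (snoc (.single (.sand ys)) zs))) (.sand (glue xs (snoc ys zs)))
  /- (E5) OR(A) = A -/
  | ax5 (t : SandTree B) : DerivSP (.or (.single t)) t
  /- (E6) AND(A) = A -/
  | ax6 (t : SandTree B) : DerivSP (.and (.single t)) t
  /- (E6') SAND(A) = A -/
  | ax6' (t : SandTree B) : DerivSP (.sand (.single t)) t
  /- (E10) AND(X⃗, OR(Y⃗)) = OR(AND(X⃗,Y₁),…,AND(X⃗,Yₗ)) -/
  | ax10 (xs : List (SandTree B)) (ys : SandTreeList B) :
      DerivSP (.and (glue xs (.single (.or ys))))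
        (.or (SandTreeList.map (fun y => .and (glue xs (.single y))) ys))
  /- (E10') SAND(X⃗, OR(Y⃗), Z⃗) = OR(SAND(X⃗,Y₁,Z⃗),…,SAND(X⃗,Yₗ,Z⃗)) -/
  | ax10' (xs : List (SandTree B)) (ys : SandTreeList B) (zs : List (SandTree B)) :
      DerivSP (.sand (glue xs (snoc (.single (.or ys)) zs)))
        (.or (SandTreeList.map (fun y => .sand (glue xs (snoc (.single y) zs))) ys))
  /- (E11) OR(A, A, X⃗) = OR(A, X⃗) -/
  | ax11 (a : SandTree B) (xs : List (SandTree B)) :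
      DerivSP (.or (.cons a (ofList a xs))) (.or (ofList a xs))
inductive DerivSPL {B : Type} : SandTreeList B → SandTreeList B → Prop
  | single {t t' : SandTree B} : DerivSP t t' → DerivSPL (.single t) (.single t')
  | cons {t t' : SandTree B} {ts ts' : SandTreeList B} :
      DerivSP t t' → DerivSPL ts ts' → DerivSPL (.cons t ts) (.cons t' ts')
end
end

/-! Syntactic consequence from the SAND-free fragment
`E_SM = {E1, E2, E3, E4, E5, E6, E10, E11}` of `E_SP` (formulated over the full
signature of SAND attack trees). -/
section
open SandTreeList
mutual
inductive DerivSM {B : Type} : SandTree B → SandTree B → Prop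
  | refl (t : SandTree B) : DerivSM t t
  | symm {t u : SandTree B} : DerivSM t u → DerivSM u t
  | trans {t u v : SandTree B} : DerivSM t u → DerivSM u v → DerivSM t v
  | congrOr {ts ts' : SandTreeList B} : DerivSML ts ts' → DerivSM (.or ts) (.or ts')
  | congrAnd {ts ts' : SandTreeList B} : DerivSML ts ts' → DerivSM (.and ts) (.and ts')
  | congrSand {ts ts' : SandTreeList B} : DerivSML ts ts' → DerivSM (.sand ts) (.sand ts')
  | ax1 {ts ts' : SandTreeList B} : ts.toList.Perm ts'.toList → DerivSM (.or ts) (.or ts')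
  | ax2 {ts ts' : SandTreeList B} : ts.toList.Perm ts'.toList → DerivSM (.and ts) (.and ts')
  | ax3 (xs : List (SandTree B)) (ys : SandTreeList B) :
      DerivSM (.or (glue xs (.single (.or ys)))) (.or (glue xs ys))
  | ax4 (xs : List (SandTree B)) (ys : SandTreeList B) :
      DerivSM (.and (glue xs (.single (.and ys)))) (.and (glue xs ys))
  | ax5 (t : SandTree B) : DerivSM (.or (.single t)) t
  | ax6 (t : SandTree B) : DerivSM (.and (.single t)) t
  | ax10 (xs : List (SandTree B)) (ys : SandTreeList B) :
      DerivSM (.and (glue xs (.single (.or ys))))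
        (.or (SandTreeList.map (fun y => .and (glue xs (.single y))) ys))
  | ax11 (a : SandTree B) (xs : List (SandTree B)) :
      DerivSM (.or (.cons a (ofList a xs))) (.or (ofList a xs))
inductive DerivSML {B : Type} : SandTreeList B → SandTreeList B → Prop
  | single {t t' : SandTree B} : DerivSM t t' → DerivSML (.single t) (.single t')
  | cons {t t' : SandTree B} {ts ts' : SandTreeList B} :
      DerivSM t t' → DerivSML ts ts' → DerivSML (.cons t ts) (.cons t' ts')
end
end
/-!
The normal-form grammar (for `k ≥ 2`, `b ∈ B`):
`N ::= A | OR(A₁,…,A_k)` (with pairwise distinct `Aᵢ`),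
`A ::= C | S`, `C ::= b | AND(S₁,…,S_k)`, `S ::= b | SAND(C₁,…,C_k)`.
-/

mutual
inductive IsC {B : Type} : SandTree B → Prop
  | atom (b : B) : IsC (.atom b)
  | and {ts : SandTreeList B} : 2 ≤ ts.toList.length → IsSL ts → IsC (.and ts)
inductive IsS {B : Type} : SandTree B → Prop
  | atom (b : B) : IsS (.atom b)
  | sand {ts : SandTreeList B} : 2 ≤ ts.toList.length → IsCL ts → IsS (.sand ts)
inductive IsSL {B : Type} : SandTreeList B → Prop
  | single {t : SandTree B} : IsS t → IsSL (.single t)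
  | cons {t : SandTree B} {ts : SandTreeList B} : IsS t → IsSL ts → IsSL (.cons t ts)
inductive IsCL {B : Type} : SandTreeList B → Prop
  | single {t : SandTree B} : IsC t → IsCL (.single t)
  | cons {t : SandTree B} {ts : SandTreeList B} : IsC t → IsCL ts → IsCL (.cons t ts)
end

/-- Terms generated by the non-terminal `A` of the normal-form grammar. -/
def IsA {B : Type} (t : SandTree B) : Prop := IsC t ∨ IsS t

/-- Terms generated by the non-terminal `N` of the normal-form grammar; as terms
are considered modulo commutativity of `OR` and `AND`, the arguments of the `OR`
are required to be pairwise distinct modulo commutativity. -/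
def IsN {B : Type} (t : SandTree B) : Prop :=
  IsA t ∨ ∃ ts : SandTreeList B, t = .or ts ∧ 2 ≤ ts.toList.length ∧
    (∀ u ∈ ts.toList, IsA u) ∧ ts.toList.Pairwise (fun a b => ¬ PEq a b)

/-!
The term rewriting system obtained by orienting the axioms
(E3), (E4), (E4'), (E5), (E6), (E6'), (E10), (E10'), (E11) from left to right,
applied in any context, modulo commutativity of `OR` and `AND`.
-/

section
open SandTreeList

/-- Rule application at the root. -/
inductive RStep {B : Type} : SandTree B → SandTree B → Prop
  | r3 (xs : List (SandTree B)) (ys : SandTreeList B) :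
      RStep (.or (glue xs (.single (.or ys)))) (.or (glue xs ys))
  | r4 (xs : List (SandTree B)) (ys : SandTreeList B) :
      RStep (.and (glue xs (.single (.and ys)))) (.and (glue xs ys))
  | r4' (xs : List (SandTree B)) (ys : SandTreeList B) (zs : List (SandTree B)) :
      RStep (.sand (glue xs (snoc (.single (.sand ys)) zs))) (.sand (glue xs (snoc ys zs)))
  | r5 (t : SandTree B) : RStep (.or (.single t)) t
  | r6 (t : SandTree B) : RStep (.and (.single t)) t
  | r6' (t : SandTree B) : RStep (.sand (.single t)) t
  | r10 (xs : List (SandTree B)) (ys : SandTreeList B) :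
      RStep (.and (glue xs (.single (.or ys))))
        (.or (SandTreeList.map (fun y => .and (glue xs (.single y))) ys))
  | r10' (xs : List (SandTree B)) (ys : SandTreeList B) (zs : List (SandTree B)) :
      RStep (.sand (glue xs (snoc (.single (.or ys)) zs)))
        (.or (SandTreeList.map (fun y => .sand (glue xs (snoc (.single y) zs))) ys))
  | r11 (a : SandTree B) (xs : List (SandTree B)) :
      RStep (.or (.cons a (ofList a xs))) (.or (ofList a xs))

end

/-! Rule application in an arbitrary context. -/
mutual
inductive Rw {B : Type} : SandTree B → SandTree B → Prop
  | root {t t' : SandTree B} : RStep t t' → Rw t t'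
  | or {ts ts' : SandTreeList B} : RwL ts ts' → Rw (.or ts) (.or ts')
  | and {ts ts' : SandTreeList B} : RwL ts ts' → Rw (.and ts) (.and ts')
  | sand {ts ts' : SandTreeList B} : RwL ts ts' → Rw (.sand ts) (.sand ts')
inductive RwL {B : Type} : SandTreeList B → SandTreeList B → Prop
  | single {t t' : SandTree B} : Rw t t' → RwL (.single t) (.single t')
  | head {t t' : SandTree B} {ts : SandTreeList B} : Rw t t' → RwL (.cons t ts) (.cons t' ts)
  | tail {t : SandTree B} {ts ts' : SandTreeList B} : RwL ts ts' → RwL (.cons t ts) (.cons t ts')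
end

/-- One rewrite step of the TRS `⇒`, working modulo commutativity of `OR` and `AND`. -/
def RwMod {B : Type} (t t' : SandTree B) : Prop :=
  ∃ u u' : SandTree B, PEq t u ∧ Rw u u' ∧ PEq u' t'

/-- Zero or more rewrite steps (modulo commutativity of `OR` and `AND`). -/
def RwStar {B : Type} : SandTree B → SandTree B → Prop :=
  Relation.ReflTransGen (fun a b => PEq a b ∨ Rw a b)

/-- A normal form: no rewrite rule is applicable, modulo commutativity of `OR` and `AND`. -/
def NormalForm {B : Type} (t : SandTree B) : Prop :=
  ∀ u t' : SandTree B, PEq t u → ¬ Rw u t'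

/-! The norm `‖·‖`: `‖b‖ = 1`, `‖OR(t₁,…,t_k)‖ = ‖t₁‖+…+‖t_k‖+2`,
`‖AND(t₁,…,t_k)‖ = ‖SAND(t₁,…,t_k)‖ = 2·‖t₁‖·…·‖t_k‖`. -/
mutual
def weight {B : Type} : SandTree B → ℕ
  | .atom _ => 1
  | .or ts => weightSum ts + 2
  | .and ts => 2 * weightProd ts
  | .sand ts => 2 * weightProd ts
def weightSum {B : Type} : SandTreeList B → ℕ
  | .single t => weight t
  | .cons t ts => weight t + weightSum ts
def weightProd {B : Type} : SandTreeList B → ℕ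
  | .single t => weight t
  | .cons t ts => weight t * weightProd ts
end
/-!
Standard attack trees are SAND attack trees containing no `SAND` operator.
The multiset semantics maps a standard attack tree to a set of finite multisets
over `B`: `⟦b⟧_M = {⟨b⟩}`, `⟦OR⟧_M = ⋃ᵢ ⟦tᵢ⟧_M`,
`⟦AND⟧_M = {M₁ ⊎ … ⊎ M_k | Mᵢ ∈ ⟦tᵢ⟧_M}`.
(Its value on trees containing `SAND` is irrelevant and set to `∅`.)
-/

mutual
inductive NoSand {B : Type} : SandTree B → Prop
  | atom (b : B) : NoSand (.atom b)
  | or {ts : SandTreeList B} : NoSandL ts → NoSand (.or ts)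
  | and {ts : SandTreeList B} : NoSandL ts → NoSand (.and ts)
inductive NoSandL {B : Type} : SandTreeList B → Prop
  | single {t : SandTree B} : NoSand t → NoSandL (.single t)
  | cons {t : SandTree B} {ts : SandTreeList B} : NoSand t → NoSandL ts → NoSandL (.cons t ts)
end

mutual
def msem {B : Type} : SandTree B → Set (Multiset B)
  | .atom b => {({b} : Multiset B)}
  | .or ts => msemOr ts
  | .and ts => msemAnd ts
  | .sand _ => ∅
def msemOr {B : Type} : SandTreeList B → Set (Multiset B)
  | .single t => msem t
  | .cons t ts => msem t ∪ msemOr ts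
def msemAnd {B : Type} : SandTreeList B → Set (Multiset B)
  | .single t => msem t
  | .cons t ts => {M | ∃ M1 ∈ msem t, ∃ M2 ∈ msemAnd ts, M = M1 + M2}
end

/-- Parallel composition of a nonempty list of graphs `G ∥ H₁ ∥ … ∥ H_k`. -/
def parAll {B : Type} : SSG B → List (SSG B) → SSG B
  | G, [] => G
  | G, H :: Hs => parAll (G.par H) Hs

/-- SAND attack trees modulo equivalence with respect to the SP semantics
(`t ~ t'` iff `⟦t⟧ = ⟦t'⟧`). -/
def semSetoid (B : Type) : Setoid (SandTree B) :=
  ⟨fun t t' => sem t = sem t', fun _ => rfl, Eq.symm, Eq.trans⟩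

/-- The map induced by the SP semantics on equivalence classes of SAND attack trees. -/
def semClass {B : Type} : Quotient (semSetoid B) → Set (SSG B) :=
  Quotient.lift sem (fun _ _ h => h)

/-!
Bottom-up evaluation of the minimal attack time attribute on SAND attack trees:
`α(b) = β(b)`, `α(OR) = min`, `α(AND) = max`, `α(SAND) = Σ`.
-/

mutual
def attr {B : Type} (β : B → NNReal) : SandTree B → NNReal
  | .atom b => β b
  | .or ts => attrOr β ts
  | .and ts => attrAnd β ts
  | .sand ts => attrSand β ts
def attrOr {B : Type} (β : B → NNReal) : SandTreeList B → NNReal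
  | .single t => attr β t
  | .cons t ts => min (attr β t) (attrOr β ts)
def attrAnd {B : Type} (β : B → NNReal) : SandTreeList B → NNReal
  | .single t => attr β t
  | .cons t ts => max (attr β t) (attrAnd β ts)
def attrSand {B : Type} (β : B → NNReal) : SandTreeList B → NNReal
  | .single t => attr β t
  | .cons t ts => attr β t + attrSand β ts
end
/-!
Standard attack trees as a standalone signature (`B ∪ {OR, AND}`, unranked
operators with `k ≥ 1` arguments), their multiset semantics, and syntactic
consequence from the axiom system `E_SM`.
-/

mutual
inductive ATree (B : Type) : Type
  | atom : B → ATree B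
  | or : ATreeList B → ATree B
  | and : ATreeList B → ATree B
inductive ATreeList (B : Type) : Type
  | single : ATree B → ATreeList B
  | cons : ATree B → ATreeList B → ATreeList B
end

namespace ATreeList

variable {B : Type}

def toList : ATreeList B → List (ATree B)
  | .single t => [t]
  | .cons t ts => t :: ts.toList

def glue : List (ATree B) → ATreeList B → ATreeList B
  | [], ys => ys
  | x :: xs, ys => .cons x (glue xs ys)

def ofList : ATree B → List (ATree B) → ATreeList B
  | t, [] => .single t
  | t, u :: us => .cons t (ofList u us)

def map (f : ATree B → ATree B) : ATreeList B → ATreeList B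
  | .single t => .single (f t)
  | .cons t ts => .cons (f t) (map f ts)

end ATreeList

/-! The multiset semantics of standard attack trees. -/

mutual
def amsem {B : Type} : ATree B → Set (Multiset B)
  | .atom b => {({b} : Multiset B)}
  | .or ts => amsemOr ts
  | .and ts => amsemAnd ts
def amsemOr {B : Type} : ATreeList B → Set (Multiset B)
  | .single t => amsem t
  | .cons t ts => amsem t ∪ amsemOr ts
def amsemAnd {B : Type} : ATreeList B → Set (Multiset B)
  | .single t => amsem t
  | .cons t ts => {M | ∃ M1 ∈ amsem t, ∃ M2 ∈ amsemAnd ts, M = M1 + M2}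
end

/-!
Syntactic consequence from `E_SM = {E1, E2, E3, E4, E5, E6, E10, E11}`.
Axiom schemes are represented by all of their instances (closure under
substitution is then automatic), and closure under replacement in contexts is
represented by the congruence rules.
-/

section
open ATreeList
mutual
inductive DerivASM {B : Type} : ATree B → ATree B → Prop
  | refl (t : ATree B) : DerivASM t t
  | symm {t u : ATree B} : DerivASM t u → DerivASM u t
  | trans {t u v : ATree B} : DerivASM t u → DerivASM u v → DerivASM t v
  | congrOr {ts ts' : ATreeList B} : DerivASML ts ts' → DerivASM (.or ts) (.or ts')
  | congrAnd {ts ts' : ATreeList B} : DerivASML ts ts' → DerivASM (.and ts) (.and ts')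
  /- (E1) -/
  | ax1 {ts ts' : ATreeList B} : ts.toList.Perm ts'.toList → DerivASM (.or ts) (.or ts')
  /- (E2) -/
  | ax2 {ts ts' : ATreeList B} : ts.toList.Perm ts'.toList → DerivASM (.and ts) (.and ts')
  /- (E3) -/
  | ax3 (xs : List (ATree B)) (ys : ATreeList B) :
      DerivASM (.or (glue xs (.single (.or ys)))) (.or (glue xs ys))
  /- (E4) -/
  | ax4 (xs : List (ATree B)) (ys : ATreeList B) :
      DerivASM (.and (glue xs (.single (.and ys)))) (.and (glue xs ys))
  /- (E5) -/
  | ax5 (t : ATree B) : DerivASM (.or (.single t)) t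
  /- (E6) -/
  | ax6 (t : ATree B) : DerivASM (.and (.single t)) t
  /- (E10) -/
  | ax10 (xs : List (ATree B)) (ys : ATreeList B) :
      DerivASM (.and (glue xs (.single (.or ys))))
        (.or (ATreeList.map (fun y => .and (glue xs (.single y))) ys))
  /- (E11) -/
  | ax11 (a : ATree B) (xs : List (ATree B)) :
      DerivASM (.or (.cons a (ofList a xs))) (.or (ofList a xs))
inductive DerivASML {B : Type} : ATreeList B → ATreeList B → Prop
  | single {t t' : ATree B} : DerivASM t t' → DerivASML (.single t) (.single t')
  | cons {t t' : ATree B} {ts ts' : ATreeList B} :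
      DerivASM t t' → DerivASML ts ts' → DerivASML (.cons t ts) (.cons t' ts')
end
end

namespace SSG

variable {B : Type}

/-- `h` assigns a time to every vertex so that every edge has enough time to be traversed. -/
def IsSchedule (β : B → NNReal) (G : SSG B) (h : G.V → NNReal) : Prop :=
  ∀ e ∈ G.E, h e.1 + β e.2.1 ≤ h e.2.2

/-- There is a schedule that starts at time `a` and ends at time `c`. -/
def Schedulable (β : B → NNReal) (G : SSG B) (a c : NNReal) : Prop :=
  ∃ h, G.IsSchedule β h ∧ h G.s = a ∧ h G.z = c

/-- The least duration of a schedule is `r`. -/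
def HasTime (β : B → NNReal) (G : SSG B) (r : NNReal) : Prop :=
  ∀ a c, G.Schedulable β a c ↔ a + r ≤ c

variable {β : B → NNReal} {G G' : SSG B} {r r' : NNReal}

theorem HasTime.unique (h : G.HasTime β r) (h' : G.HasTime β r') : r = r' := by
  have key (x : NNReal) : r ≤ x ↔ r' ≤ x := by
    simpa using (h 0 x).symm.trans (h' 0 x)
  exact eq_of_forall_ge_iff key

theorem hasTime_single (β : B → NNReal) (b : B) : (single b).HasTime β (β b) := by
  intro a c
  constructor
  · rintro ⟨h, hh, rfl, rfl⟩
    exact hh (false, b, true) (Multiset.mem_singleton_self _)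
  · intro hac
    refine ⟨fun v : Bool => if v then c else a, fun e he => ?_, rfl, rfl⟩
    obtain rfl : e = (false, b, true) := Multiset.mem_singleton.1 he
    simpa using hac

theorem Schedulable.of_iso {a c : NNReal} (i : G.Iso G') (h : G'.Schedulable β a c) :
    G.Schedulable β a c := by
  obtain ⟨f, hE, hs, hz⟩ := i
  obtain ⟨h, hh, rfl, rfl⟩ := h
  refine ⟨h ∘ f, fun e he => ?_, by simp [hs], by simp [hz]⟩
  exact hh (f e.1, e.2.1, f e.2.2) (hE ▸ Multiset.mem_map_of_mem _ he)

theorem Iso.symm (i : G.Iso G') : G'.Iso G := by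
  obtain ⟨f, hE, hs, hz⟩ := i
  refine ⟨f.symm, ?_, by simp [← hs], by simp [← hz]⟩
  simp [← hE]

theorem HasTime.iso (h : G.HasTime β r) (i : G.Iso G') : G'.HasTime β r := fun a c =>
  ⟨fun hs => (h a c).1 (hs.of_iso i), fun hr => ((h a c).2 hr).of_iso i.symm⟩

theorem Iso.refl (G : SSG B) : G.Iso G := ⟨Equiv.refl _, by simp, rfl, rfl⟩

theorem seqEmbed_z : G.seqEmbed G' G.z = Sum.inr G'.s := by simp [seqEmbed]

theorem seqEmbed_s : G.seqEmbed G' G.s = Sum.inl ⟨G.s, G.ne⟩ := by simp [seqEmbed, G.ne]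

theorem elim_seqEmbed {f : G.V → NNReal} {g : G'.V → NNReal} (h : f G.z = g G'.s) (v : G.V) :
    Sum.elim (fun u : {u : G.V // u ≠ G.z} => f u) g (G.seqEmbed G' v) = f v := by
  unfold seqEmbed
  split_ifs with hv
  · simp [hv, h]
  · rfl

theorem parEmbed_s : G.parEmbed G' G.s = Sum.inr G'.s := by simp [parEmbed]

theorem parEmbed_z : G.parEmbed G' G.z = Sum.inr G'.z := by simp [parEmbed, G.ne.symm]

theorem elim_parEmbed {f : G.V → NNReal} {g : G'.V → NNReal} (hs : f G.s = g G'.s)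
    (hz : f G.z = g G'.z) (v : G.V) :
    Sum.elim (fun u : {u : G.V // u ≠ G.s ∧ u ≠ G.z} => f u) g (G.parEmbed G' v) = f v := by
  unfold parEmbed
  split_ifs with hv hv'
  · simp [hv, hs]
  · simp [hv', hz]
  · rfl

theorem forall_mem_map_add_map_iff {ι κ γ : Type*} {s : Multiset ι} {t : Multiset κ} {f : ι → γ}
    {g : κ → γ} {p : γ → Prop} :
    (∀ e ∈ s.map f + t.map g, p e) ↔ (∀ i ∈ s, p (f i)) ∧ ∀ k ∈ t, p (g k) := by
  simp only [Multiset.mem_add, or_imp, forall_and, Multiset.forall_mem_map_iff]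

theorem isSchedule_seq_iff {h : {u : G.V // u ≠ G.z} ⊕ G'.V → NNReal} :
    (G.seq G').IsSchedule β h ↔
      G.IsSchedule β (fun v => h (G.seqEmbed G' v)) ∧ G'.IsSchedule β (fun v => h (.inr v)) :=
  forall_mem_map_add_map_iff

theorem isSchedule_par_iff {h : {u : G.V // u ≠ G.s ∧ u ≠ G.z} ⊕ G'.V → NNReal} :
    (G.par G').IsSchedule β h ↔
      G.IsSchedule β (fun v => h (G.parEmbed G' v)) ∧ G'.IsSchedule β (fun v => h (.inr v)) :=
  forall_mem_map_add_map_iff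

theorem schedulable_seq_iff {a c : NNReal} :
    (G.seq G').Schedulable β a c ↔ ∃ b, G.Schedulable β a b ∧ G'.Schedulable β b c := by
  constructor
  · rintro ⟨h, hh, rfl, rfl⟩
    obtain ⟨h₁, h₂⟩ := isSchedule_seq_iff.1 hh
    exact ⟨h (.inr G'.s), ⟨_, h₁, congrArg h seqEmbed_s, congrArg h seqEmbed_z⟩, _, h₂, rfl, rfl⟩
  · rintro ⟨b, ⟨f, hf, rfl, hfz⟩, g, hg, hgs, rfl⟩
    refine ⟨Sum.elim (fun u => f u) g, isSchedule_seq_iff.2 ⟨?_, hg⟩, rfl, rfl⟩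
    simpa only [elim_seqEmbed (hfz.trans hgs.symm)] using hf

theorem schedulable_par_iff {a c : NNReal} :
    (G.par G').Schedulable β a c ↔ G.Schedulable β a c ∧ G'.Schedulable β a c := by
  constructor
  · rintro ⟨h, hh, rfl, rfl⟩
    obtain ⟨h₁, h₂⟩ := isSchedule_par_iff.1 hh
    exact ⟨⟨_, h₁, congrArg h parEmbed_s, congrArg h parEmbed_z⟩, _, h₂, rfl, rfl⟩
  · rintro ⟨⟨f, hf, hfs, hfz⟩, g, hg, hgs, hgz⟩
    refine ⟨Sum.elim (fun u => f u) g, isSchedule_par_iff.2 ⟨?_, hg⟩, hgs, hgz⟩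
    simpa only [elim_parEmbed (hfs.trans hgs.symm) (hfz.trans hgz.symm)] using hf

theorem HasTime.seq (h : G.HasTime β r) (h' : G'.HasTime β r') :
    (G.seq G').HasTime β (r + r') := by
  intro a c
  simp only [schedulable_seq_iff, h _ _, h' _ _]
  constructor
  · rintro ⟨b, hb, hc⟩
    rw [← add_assoc]
    exact (add_le_add_left hb r').trans hc
  · exact fun hc => ⟨a + r, le_rfl, by rwa [add_assoc]⟩

theorem HasTime.par (h : G.HasTime β r) (h' : G'.HasTime β r') :
    (G.par G').HasTime β (max r r') := by
  intro a c
  rw [schedulable_par_iff, h, h', ← max_add_add_left, max_le_iff]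

/-- Every graph in `S` has a time, and the least of these times is `r`. -/
def IsMinTime (β : B → NNReal) (S : Set (SSG B)) (r : NNReal) : Prop :=
  (∃ G ∈ S, G.HasTime β r) ∧ ∀ G ∈ S, ∃ x, r ≤ x ∧ G.HasTime β x

variable {S S' : Set (SSG B)}

theorem IsMinTime.le (h : IsMinTime β S r) (h' : IsMinTime β S r') : r ≤ r' := by
  obtain ⟨G, hG, hr'⟩ := h'.1
  obtain ⟨x, hx, hGx⟩ := h.2 G hG
  exact hx.trans_eq (hGx.unique hr')

theorem IsMinTime.union (h : IsMinTime β S r) (h' : IsMinTime β S' r') :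
    IsMinTime β (S ∪ S') (min r r') := by
  constructor
  · rcases le_total r r' with hr | hr
    · obtain ⟨G, hG, ht⟩ := h.1
      exact ⟨G, .inl hG, by rwa [min_eq_left hr]⟩
    · obtain ⟨G, hG, ht⟩ := h'.1
      exact ⟨G, .inr hG, by rwa [min_eq_right hr]⟩
  · rintro G (hG | hG)
    · obtain ⟨x, hx, ht⟩ := h.2 G hG
      exact ⟨x, (min_le_left _ _).trans hx, ht⟩
    · obtain ⟨x, hx, ht⟩ := h'.2 G hG
      exact ⟨x, (min_le_right _ _).trans hx, ht⟩

theorem IsMinTime.par (h : IsMinTime β S r) (h' : IsMinTime β S' r') :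
    IsMinTime β {G | ∃ G₁ ∈ S, ∃ G₂ ∈ S', (G₁.par G₂).Iso G} (max r r') := by
  constructor
  · obtain ⟨G₁, h₁, t₁⟩ := h.1
    obtain ⟨G₂, h₂, t₂⟩ := h'.1
    exact ⟨_, ⟨G₁, h₁, G₂, h₂, Iso.refl _⟩, t₁.par t₂⟩
  · rintro G ⟨G₁, h₁, G₂, h₂, i⟩
    obtain ⟨x₁, hx₁, t₁⟩ := h.2 G₁ h₁
    obtain ⟨x₂, hx₂, t₂⟩ := h'.2 G₂ h₂
    exact ⟨_, max_le_max hx₁ hx₂, (t₁.par t₂).iso i⟩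

theorem IsMinTime.seq (h : IsMinTime β S r) (h' : IsMinTime β S' r') :
    IsMinTime β {G | ∃ G₁ ∈ S, ∃ G₂ ∈ S', (G₁.seq G₂).Iso G} (r + r') := by
  constructor
  · obtain ⟨G₁, h₁, t₁⟩ := h.1
    obtain ⟨G₂, h₂, t₂⟩ := h'.1
    exact ⟨_, ⟨G₁, h₁, G₂, h₂, Iso.refl _⟩, t₁.seq t₂⟩
  · rintro G ⟨G₁, h₁, G₂, h₂, i⟩
    obtain ⟨x₁, hx₁, t₁⟩ := h.2 G₁ h₁
    obtain ⟨x₂, hx₂, t₂⟩ := h'.2 G₂ h₂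
    exact ⟨_, add_le_add hx₁ hx₂, (t₁.seq t₂).iso i⟩

end SSG

mutual
theorem isMinTime_sem {B : Type} (β : B → NNReal) :
    ∀ t : SandTree B, SSG.IsMinTime β (sem t) (attr β t)
  | .atom b => by
    rw [sem, attr]
    exact ⟨⟨_, SSG.Iso.refl _, SSG.hasTime_single β b⟩,
      fun _ i => ⟨_, le_rfl, (SSG.hasTime_single β b).iso i⟩⟩
  | .or ts => by
    rw [sem, attr]
    exact isMinTime_semOr β ts
  | .and ts => by
    rw [sem, attr]
    exact isMinTime_semAnd β ts
  | .sand ts => by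
    rw [sem, attr]
    exact isMinTime_semSand β ts
theorem isMinTime_semOr {B : Type} (β : B → NNReal) :
    ∀ ts : SandTreeList B, SSG.IsMinTime β (semOr ts) (attrOr β ts)
  | .single t => by
    rw [semOr, attrOr]
    exact isMinTime_sem β t
  | .cons t ts => by
    rw [semOr, attrOr]
    exact (isMinTime_sem β t).union (isMinTime_semOr β ts)
theorem isMinTime_semAnd {B : Type} (β : B → NNReal) :
    ∀ ts : SandTreeList B, SSG.IsMinTime β (semAnd ts) (attrAnd β ts)
  | .single t => by
    rw [semAnd, attrAnd]
    exact isMinTime_sem β t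
  | .cons t ts => by
    rw [semAnd, attrAnd]
    exact (isMinTime_sem β t).par (isMinTime_semAnd β ts)
theorem isMinTime_semSand {B : Type} (β : B → NNReal) :
    ∀ ts : SandTreeList B, SSG.IsMinTime β (semSand ts) (attrSand β ts)
  | .single t => by
    rw [semSand, attrSand]
    exact isMinTime_sem β t
  | .cons t ts => by
    rw [semSand, attrSand]
    exact (isMinTime_sem β t).seq (isMinTime_semSand β ts)
end

/-- The attribute domain for minimal attack time
(`min` for `OR`, `max` for `AND`, `Σ` for `SAND`) is compatible with the SP
semantics: semantically equivalent SAND attack trees get the same value. -/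
theorem minTime_compatible (B : Type) (β : B → NNReal) (t t' : SandTree B)
    (h : sem t = sem t') : attr β t = attr β t' := by
  have ht' : SSG.IsMinTime β (sem t) (attr β t') := h ▸ isMinTime_sem β t'
  exact ((isMinTime_sem β t).le ht').antisymm (ht'.le (isMinTime_sem β t))
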